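/- arXiv:math/0609492 — 4 statements merged into one kernel-verified Lean document; each statement's English description precedes it below -/
import Mathlib

section
/- Let (Ω, μ) be a measure space with 0 < μ(Ω) = V < ∞, let k ≥ 1, R > 0, and let r : Ω → ℝ be measurable with 0 ≤ r ≤ R μ-almost everywhere. Let H₀ = 1 and let H₁, …, H_k : Ω → ℝ be integrable functions, positive μ-a.e., such that the functions H_j · r are integrable and ∫ H_{j−1} dμ ≤ ∫ H_j · r dμ for every 1 ≤ j ≤ k. Then: (a) V ≤ R^k · ∫ H_k dμ; (b) for every p ≥ 1 with H_k ∈ L^p(μ), R^k ≥ V^{1/p} / ‖H_k‖_{L^p(μ)}; (c) if V = R^k ∫ H_k dμ then r = R μ-almost everywhere. -/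
open MeasureTheory

/-- The power mean inequality for integrals over a finite measure space of total mass `V`. -/
theorem rpow_mul_integral_div_le_rpow_integral_abs_rpow {Ω : Type*} [MeasurableSpace Ω]
    {μ : Measure Ω} {V : ℝ} (hV : 0 < V) (hμV : μ Set.univ = ENNReal.ofReal V)
    {f : Ω → ℝ} (hf : Integrable f μ) {p : ℝ} (hp : 1 ≤ p)
    (hfp : Integrable (fun x => |f x| ^ p) μ) :
    V ^ (1 / p) * ((∫ x, f x ∂μ) / V) ≤ (∫ x, |f x| ^ p ∂μ) ^ (1 / p) := by
  have hp0 : 0 < p := by linarith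
  have : IsFiniteMeasure μ := ⟨by rw [hμV]; exact ENNReal.ofReal_lt_top⟩
  have : NeZero μ := ⟨fun h => by simp [h, hV.not_ge] at hμV⟩
  have hreal : μ.real Set.univ = V := by
    rw [measureReal_def, hμV, ENNReal.toReal_ofReal hV.le]
  have hJensen := (convexOn_rpow hp).map_average_le (μ := μ) (f := fun x => |f x|)
    (Real.continuous_rpow_const hp0.le).continuousOn isClosed_Ici
    (Filter.Eventually.of_forall fun x => abs_nonneg (f x)) hf.abs hfp
  simp only [average_eq, hreal, smul_eq_mul] at hJensen
  have hA : 0 ≤ ∫ x, |f x| ∂μ := integral_nonneg fun x => abs_nonneg (f x)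
  have hJ : 0 ≤ ∫ x, |f x| ^ p ∂μ :=
    integral_nonneg fun x => Real.rpow_nonneg (abs_nonneg (f x)) p
  have hle : (∫ x, f x ∂μ) / V ≤ (V⁻¹ * ∫ x, |f x| ^ p ∂μ) ^ (1 / p) := by
    calc (∫ x, f x ∂μ) / V ≤ V⁻¹ * ∫ x, |f x| ∂μ := by
          rw [div_eq_inv_mul]
          exact mul_le_mul_of_nonneg_left
            (integral_mono hf hf.abs fun x => le_abs_self (f x)) (by positivity)
      _ = ((V⁻¹ * ∫ x, |f x| ∂μ) ^ p) ^ (1 / p) := by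
          rw [one_div, Real.rpow_rpow_inv (by positivity) hp0.ne']
      _ ≤ _ := by gcongr
  calc V ^ (1 / p) * ((∫ x, f x ∂μ) / V)
      ≤ V ^ (1 / p) * (V⁻¹ * ∫ x, |f x| ^ p ∂μ) ^ (1 / p) := by gcongr
    _ = (∫ x, |f x| ^ p ∂μ) ^ (1 / p) := by
        rw [← Real.mul_rpow hV.le (by positivity), mul_inv_cancel_left₀ hV.ne']

/-- Euclidean extrinsic radius estimate (Theorem 3.2, δ = 0) in
measure-theoretic form, with equality case. -/
theorem extrinsic_radius_estimate_euclidean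
    {Ω : Type*} [MeasurableSpace Ω] (μ : Measure Ω)
    (V : ℝ) (hV : 0 < V) (hμV : μ Set.univ = ENNReal.ofReal V)
    (k : ℕ) (hk : 1 ≤ k) (R : ℝ) (hR : 0 < R)
    (r : Ω → ℝ) (hr : Measurable r) (hr' : ∀ᵐ x ∂μ, 0 ≤ r x ∧ r x ≤ R)
    (H : ℕ → Ω → ℝ) (hH0 : ∀ x, H 0 x = 1)
    (hHint : ∀ j ≤ k, Integrable (H j) μ)
    (hHpos : ∀ j, 1 ≤ j → j ≤ k → ∀ᵐ x ∂μ, 0 < H j x)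
    (hHrint : ∀ j ≤ k, Integrable (fun x => H j x * r x) μ)
    (hmink : ∀ j, 1 ≤ j → j ≤ k → ∫ x, H (j - 1) x ∂μ ≤ ∫ x, H j x * r x ∂μ) :
    (V ≤ R ^ k * ∫ x, H k x ∂μ) ∧
    (∀ p : ℝ, 1 ≤ p → Integrable (fun x => |H k x| ^ p) μ →
      V ^ (1 / p) / (∫ x, |H k x| ^ p ∂μ) ^ (1 / p) ≤ R ^ k) ∧
    (V = R ^ k * ∫ x, H k x ∂μ → ∀ᵐ x ∂μ, r x = R) := by
  have hmul : ∀ j, 1 ≤ j → j ≤ k → ∫ x, H j x * r x ∂μ ≤ R * ∫ x, H j x ∂μ := by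
    intro j hj hjk
    rw [← integral_const_mul]
    refine integral_mono_ae (hHrint j hjk) ((hHint j hjk).const_mul R) ?_
    filter_upwards [hr', hHpos j hj hjk] with x hx hHx
    rw [mul_comm R]
    exact mul_le_mul_of_nonneg_left hx.2 hHx.le
  have hchain : ∀ j ≤ k, V ≤ R ^ j * ∫ x, H j x ∂μ := by
    intro j
    induction j with
    | zero =>
      intro _
      simp [hH0, measureReal_def, hμV, hV.le]
    | succ j ih =>
      intro hj
      calc V ≤ R ^ j * ∫ x, H j x ∂μ := ih (by omega)
        _ ≤ R ^ j * (R * ∫ x, H (j + 1) x ∂μ) := by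
          gcongr
          exact (hmink (j + 1) (by omega) hj).trans (hmul (j + 1) (by omega) hj)
        _ = R ^ (j + 1) * ∫ x, H (j + 1) x ∂μ := by ring
  refine ⟨hchain k le_rfl, fun p hp hHp => ?_, fun hEq => ?_⟩
  · have hpow := rpow_mul_integral_div_le_rpow_integral_abs_rpow hV hμV (hHint k le_rfl) hp hHp
    have hone : 1 ≤ R ^ k * ((∫ x, H k x ∂μ) / V) := by
      rw [← mul_div_assoc, one_le_div hV]
      exact hchain k le_rfl
    have hJ : 0 ≤ ∫ x, |H k x| ^ p ∂μ :=
      integral_nonneg fun x => Real.rpow_nonneg (abs_nonneg (H k x)) p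
    refine div_le_of_le_mul₀ (by positivity) (by positivity) ?_
    calc V ^ (1 / p) ≤ V ^ (1 / p) * (R ^ k * ((∫ x, H k x ∂μ) / V)) :=
          le_mul_of_one_le_right (by positivity) hone
      _ = R ^ k * (V ^ (1 / p) * ((∫ x, H k x ∂μ) / V)) := by ring
      _ ≤ R ^ k * (∫ x, |H k x| ^ p ∂μ) ^ (1 / p) := by gcongr
  · have hle : R * ∫ x, H k x ∂μ ≤ ∫ x, H k x * r x ∂μ := by
      refine le_trans ?_ (hmink k hk le_rfl)
      refine le_of_mul_le_mul_left ?_ (pow_pos hR (k - 1))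
      rw [← mul_assoc, pow_sub_one_mul (by omega), ← hEq]
      exact hchain (k - 1) (by omega)
    have hint : Integrable (fun x => R * H k x - H k x * r x) μ :=
      ((hHint k le_rfl).const_mul R).sub (hHrint k le_rfl)
    have hnonneg : 0 ≤ᵐ[μ] fun x => R * H k x - H k x * r x := by
      filter_upwards [hr', hHpos k hk le_rfl] with x hx hHx
      have := mul_le_mul_of_nonneg_left hx.2 hHx.le
      simp only [Pi.zero_apply]
      linarith
    have hzero : ∫ x, (R * H k x - H k x * r x) ∂μ = 0 := by
      rw [integral_sub ((hHint k le_rfl).const_mul R) (hHrint k le_rfl), integral_const_mul]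
      linarith [hmul k hk le_rfl]
    filter_upwards [(integral_eq_zero_iff_of_nonneg_ae hnonneg hint).1 hzero,
      hHpos k hk le_rfl] with x hx hHx
    simp only [Pi.zero_apply] at hx
    exact mul_left_cancel₀ hHx.ne' (by linarith)
end

section
/- Let (Ω, μ) be a measure space with 0 < μ(Ω) = V < ∞, let k ≥ 1, let 0 < R < π/2, and let r : Ω → ℝ be measurable with 0 ≤ r ≤ R μ-almost everywhere. Let H₀ = 1 and let H₁, …, H_k : Ω → ℝ be integrable functions, positive μ-a.e., such that ∫ H_{j−1} · cos(r) dμ ≤ ∫ H_j · sin(r) dμ for every 1 ≤ j ≤ k. Then: (a) V ≤ tan(R)^k · ∫ H_k dμ; (b) for every p ≥ 1 with H_k ∈ L^p(μ), tan(R)^k ≥ V^{1/p} / ‖H_k‖_{L^p(μ)}; (c) if V = tan(R)^k ∫ H_k dμ then r = R μ-almost everywhere. -/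
open MeasureTheory Real

/-- If `f ≥ 0` and `0 ≤ r ≤ R < π / 2`, then `cos R * ∫ f ≤ ∫ f cos r` and
`∫ f sin r ≤ sin R * ∫ f`. -/
theorem cos_mul_integral_le_and_integral_le_sin_mul
    {Ω : Type*} [MeasurableSpace Ω] {μ : Measure Ω} {R : ℝ} (hR' : R < π / 2)
    {r : Ω → ℝ} (hr : Measurable r) (hr' : ∀ᵐ x ∂μ, 0 ≤ r x ∧ r x ≤ R)
    {f : Ω → ℝ} (hf : Integrable f μ) (hf0 : ∀ᵐ x ∂μ, 0 ≤ f x) :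
    cos R * ∫ x, f x ∂μ ≤ ∫ x, f x * cos (r x) ∂μ ∧
      ∫ x, f x * sin (r x) ∂μ ≤ sin R * ∫ x, f x ∂μ := by
  rw [← integral_const_mul, ← integral_const_mul]
  constructor
  · refine integral_mono_ae (hf.const_mul _)
      (hf.mul_bdd (c := 1) (by fun_prop) (ae_of_all _ fun x => abs_cos_le_one _)) ?_
    filter_upwards [hr', hf0] with x hx hfx
    rw [mul_comm]
    exact mul_le_mul_of_nonneg_left
      (cos_le_cos_of_nonneg_of_le_pi hx.1 (by linarith [pi_pos]) hx.2) hfx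
  · refine integral_mono_ae
      (hf.mul_bdd (c := 1) (by fun_prop) (ae_of_all _ fun x => abs_sin_le_one _))
      (hf.const_mul _) ?_
    filter_upwards [hr', hf0] with x hx hfx
    rw [mul_comm (sin R)]
    exact mul_le_mul_of_nonneg_left
      (sin_le_sin_of_le_of_le_pi_div_two (by linarith [pi_pos]) hR'.le hx.2) hfx

/-- Jensen's inequality for the `p`-th power on a finite measure space. -/
theorem rpow_integral_le_measureReal_rpow_mul_integral_rpow
    {Ω : Type*} [MeasurableSpace Ω] {μ : Measure Ω} [IsFiniteMeasure μ] [NeZero μ]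
    {p : ℝ} (hp : 1 ≤ p) {f : Ω → ℝ} (hf : Integrable f μ) (hf0 : ∀ᵐ x ∂μ, 0 ≤ f x)
    (hfp : Integrable (fun x => f x ^ p) μ) :
    (∫ x, f x ∂μ) ^ p ≤ μ.real Set.univ ^ (p - 1) * ∫ x, f x ^ p ∂μ := by
  have hV : 0 < μ.real Set.univ := measureReal_univ_pos
  have h := (convexOn_rpow hp).map_average_le
    (continuousOn_id.rpow_const fun _ _ => Or.inr (by linarith)) isClosed_Ici hf0 hf hfp
  simp only [average_eq, smul_eq_mul] at h
  rw [mul_rpow (by positivity) (integral_nonneg_of_ae hf0), inv_rpow hV.le,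
    inv_mul_le_iff₀ (by positivity)] at h
  rwa [rpow_sub_one hV.ne', div_eq_mul_inv, mul_assoc]

/-- spherical (open hemisphere) extrinsic radius estimate
(Theorem 3.2, δ = 1) in measure-theoretic form, with equality case. -/
theorem extrinsic_radius_estimate_sphere
    {Ω : Type*} [MeasurableSpace Ω] (μ : Measure Ω)
    (V : ℝ) (hV : 0 < V) (hμV : μ Set.univ = ENNReal.ofReal V)
    (k : ℕ) (hk : 1 ≤ k) (R : ℝ) (hR : 0 < R) (hR' : R < π / 2)
    (r : Ω → ℝ) (hr : Measurable r) (hr' : ∀ᵐ x ∂μ, 0 ≤ r x ∧ r x ≤ R)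
    (H : ℕ → Ω → ℝ) (hH0 : ∀ x, H 0 x = 1)
    (hHint : ∀ j ≤ k, Integrable (H j) μ)
    (hHpos : ∀ j, 1 ≤ j → j ≤ k → ∀ᵐ x ∂μ, 0 < H j x)
    (hmink : ∀ j, 1 ≤ j → j ≤ k →
      ∫ x, H (j - 1) x * Real.cos (r x) ∂μ ≤ ∫ x, H j x * Real.sin (r x) ∂μ) :
    (V ≤ Real.tan R ^ k * ∫ x, H k x ∂μ) ∧
    (∀ p : ℝ, 1 ≤ p → Integrable (fun x => |H k x| ^ p) μ →
      V ^ (1 / p) / (∫ x, |H k x| ^ p ∂μ) ^ (1 / p) ≤ Real.tan R ^ k) ∧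
    (V = Real.tan R ^ k * ∫ x, H k x ∂μ → ∀ᵐ x ∂μ, r x = R) := by
  have : IsFiniteMeasure μ := ⟨by simp [hμV]⟩
  have hVreal : μ.real Set.univ = V := by simp [measureReal_def, hμV, hV.le]
  have : NeZero μ := ⟨by
    rintro rfl
    simp at hVreal
    exact hV.ne hVreal⟩
  have hcos : 0 < cos R := cos_pos_of_mem_Ioo ⟨by linarith, hR'⟩
  have htan : 0 < tan R := tan_pos_of_pos_of_lt_pi_div_two hR hR'
  have hsin : sin R = cos R * tan R := by rw [mul_comm, tan_mul_cos hcos.ne']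
  have hH_nonneg : ∀ j ≤ k, ∀ᵐ x ∂μ, 0 ≤ H j x := by
    intro j hj
    rcases Nat.eq_zero_or_pos j with rfl | hj0
    · exact ae_of_all _ fun x => by simp [hH0]
    · exact (hHpos j hj0 hj).mono fun x hx => hx.le
  have hbounds := fun j hj => cos_mul_integral_le_and_integral_le_sin_mul hR' hr hr'
    (hHint j hj) (hH_nonneg j hj)
  have hstep : ∀ j, j + 1 ≤ k → ∫ x, H j x ∂μ ≤ tan R * ∫ x, H (j + 1) x ∂μ := by
    intro j hj
    have h := ((hbounds j (by omega)).1.trans (hmink (j + 1) (by omega) hj)).trans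
      (hbounds (j + 1) hj).2
    rw [hsin, mul_assoc] at h
    exact le_of_mul_le_mul_left h hcos
  have hchain : ∀ i n, i + n ≤ k → ∫ x, H i x ∂μ ≤ tan R ^ n * ∫ x, H (i + n) x ∂μ := by
    intro i n
    induction n with
    | zero => simp
    | succ n ih =>
      intro hn
      refine (ih (by omega)).trans ?_
      rw [pow_succ, mul_assoc]
      exact mul_le_mul_of_nonneg_left (hstep (i + n) (by omega)) (by positivity)
  have hI0 : ∫ x, H 0 x ∂μ = V := by simp [hH0, hVreal]
  have hmain : V ≤ tan R ^ k * ∫ x, H k x ∂μ := by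
    simpa [hI0] using hchain 0 k (by omega)
  refine ⟨hmain, fun p hp hHp => ?_, fun heq => ?_⟩
  · have hp0 : 0 < p := by linarith
    have hI : 0 ≤ ∫ x, H k x ∂μ := integral_nonneg_of_ae (hH_nonneg k le_rfl)
    have hae : (fun x => |H k x| ^ p) =ᵐ[μ] fun x => H k x ^ p :=
      (hH_nonneg k le_rfl).mono fun x hx => by simp only [abs_of_nonneg hx]
    have hN : 0 ≤ ∫ x, |H k x| ^ p ∂μ := integral_nonneg fun x => by positivity
    have hjensen := rpow_integral_le_measureReal_rpow_mul_integral_rpow hp (hHint k le_rfl)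
      (hH_nonneg k le_rfl) (hHp.congr hae)
    rw [← integral_congr_ae hae, hVreal] at hjensen
    have hVp : V ^ (p - 1) * V ≤ V ^ (p - 1) * ((tan R ^ k) ^ p * ∫ x, |H k x| ^ p ∂μ) := by
      calc V ^ (p - 1) * V = V ^ p := by rw [rpow_sub_one hV.ne', div_mul_cancel₀ _ hV.ne']
        _ ≤ (tan R ^ k * ∫ x, H k x ∂μ) ^ p := rpow_le_rpow hV.le hmain hp0.le
        _ = (tan R ^ k) ^ p * (∫ x, H k x ∂μ) ^ p := mul_rpow (by positivity) hI
        _ ≤ (tan R ^ k) ^ p * (V ^ (p - 1) * ∫ x, |H k x| ^ p ∂μ) :=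
          mul_le_mul_of_nonneg_left hjensen (by positivity)
        _ = _ := by ring
    have hle := le_of_mul_le_mul_left hVp (by positivity)
    refine div_le_of_le_mul₀ (by positivity) (by positivity) ?_
    calc V ^ (1 / p) ≤ ((tan R ^ k) ^ p * ∫ x, |H k x| ^ p ∂μ) ^ (1 / p) :=
          rpow_le_rpow hV.le hle (by positivity)
      _ = tan R ^ k * (∫ x, |H k x| ^ p ∂μ) ^ (1 / p) := by
        rw [mul_rpow (by positivity) hN, ← rpow_mul (by positivity),
          mul_one_div_cancel hp0.ne', rpow_one]
  · have h1 : tan R * ∫ x, H 1 x ∂μ ≤ V := by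
      obtain ⟨n, rfl⟩ := Nat.exists_eq_add_of_le hk
      rw [heq, pow_add, pow_one, mul_assoc]
      exact mul_le_mul_of_nonneg_left (hchain 1 n le_rfl) htan.le
    have hcosint : Integrable (fun x => cos (r x)) μ :=
      Integrable.of_bound (by fun_prop) 1 (ae_of_all _ fun x => abs_cos_le_one _)
    have hle : ∫ x, cos (r x) ∂μ ≤ cos R * V := by
      have h := (hmink 1 le_rfl hk).trans (hbounds 1 hk).2
      simp only [Nat.sub_self, hH0, one_mul] at h
      rw [hsin, mul_assoc] at h
      exact h.trans (mul_le_mul_of_nonneg_left h1 hcos.le)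
    have hnonneg : 0 ≤ᵐ[μ] fun x => cos (r x) - cos R := by
      filter_upwards [hr'] with x hx
      exact sub_nonneg.2 (cos_le_cos_of_nonneg_of_le_pi hx.1 (by linarith [pi_pos]) hx.2)
    have hint : ∫ x, (cos (r x) - cos R) ∂μ = 0 := by
      refine le_antisymm ?_ (integral_nonneg_of_ae hnonneg)
      rw [integral_sub hcosint (integrable_const _), integral_const, hVreal, smul_eq_mul]
      linarith
    have hzero := (integral_eq_zero_iff_of_nonneg_ae hnonneg
      (hcosint.sub (integrable_const _))).1 hint
    filter_upwards [hr', hzero] with x hx h0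
    exact injOn_cos ⟨hx.1, by linarith [pi_pos]⟩ ⟨hR.le, by linarith [pi_pos]⟩ (sub_eq_zero.1 h0)
end

section
/- Let (Ω, μ) be a probability measure space, let k ≥ 2, p ≥ 1, R > 0, and let r : Ω → ℝ be measurable with 0 ≤ r ≤ R μ-almost everywhere. Let H₀ = 1 and let H₁, …, H_k : Ω → ℝ be positive μ-a.e., with H_k ∈ L^{2p}(μ) and h := ‖H_k‖_{L^{2p}(μ)}, and assume ∫ H_{j−1} dμ ≤ ∫ H_j · r dμ for every 1 ≤ j ≤ k. If 0 < C < 1 and R^k < 1/h + C, then ∫ (R² − r²)² dμ ≤ C · ( h^{(2k−4)/k} + 2 h^{(k−4)/k} ). -/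
open MeasureTheory

/-- The iterated Hsiung–Minkowski inequality: if `∫ H (j - 1) ≤ ∫ H j * r` and `0 ≤ r ≤ R`,
then `1 ≤ R ^ j * ∫ H j`. -/
lemma one_le_pow_mul_integral
    {Ω : Type*} [MeasurableSpace Ω] {μ : Measure Ω} [IsProbabilityMeasure μ]
    {k : ℕ} {R : ℝ} (hR : 0 ≤ R) {r : Ω → ℝ} (hrR : ∀ᵐ x ∂μ, r x ≤ R)
    {H : ℕ → Ω → ℝ} (hH0 : ∀ x, H 0 x = 1)
    (hHint : ∀ j ≤ k, Integrable (H j) μ)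
    (hHpos : ∀ j, 1 ≤ j → j ≤ k → ∀ᵐ x ∂μ, 0 < H j x)
    (hHrint : ∀ j ≤ k, Integrable (fun x => H j x * r x) μ)
    (hmink : ∀ j, 1 ≤ j → j ≤ k → ∫ x, H (j - 1) x ∂μ ≤ ∫ x, H j x * r x ∂μ)
    {j : ℕ} (hj : j ≤ k) : 1 ≤ R ^ j * ∫ x, H j x ∂μ := by
  induction j with
  | zero => simp [hH0]
  | succ j ih =>
    have hstep : ∫ x, H j x ∂μ ≤ R * ∫ x, H (j + 1) x ∂μ := by
      refine (hmink (j + 1) (by lia) hj).trans ?_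
      rw [← integral_const_mul]
      refine integral_mono_ae (hHrint _ hj) ((hHint _ hj).const_mul R) ?_
      filter_upwards [hrR, hHpos (j + 1) (by lia) hj] with x hx hHx
      nlinarith
    calc 1 ≤ R ^ j * ∫ x, H j x ∂μ := ih (by lia)
      _ ≤ R ^ j * (R * ∫ x, H (j + 1) x ∂μ) := by gcongr
      _ = R ^ (j + 1) * ∫ x, H (j + 1) x ∂μ := by ring

/-- Cauchy–Schwarz on a probability space, with the `L²` norm of one factor bounded by its
`L^q` norm for `2 ≤ q`. -/
lemma integral_mul_le_rpow_integral_mul_sqrt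
    {Ω : Type*} [MeasurableSpace Ω] {μ : Measure Ω} [IsProbabilityMeasure μ]
    {q : ℝ} (hq : 2 ≤ q) {f g : Ω → ℝ} (hf : AEStronglyMeasurable f μ)
    (hf0 : 0 ≤ᵐ[μ] f) (hg0 : 0 ≤ᵐ[μ] g)
    (hfq : Integrable (fun x => |f x| ^ q) μ) (hg : MemLp g 2 μ) :
    ∫ x, f x * g x ∂μ ≤ (∫ x, |f x| ^ q ∂μ) ^ (1 / q) * √(∫ x, g x ^ 2 ∂μ) := by
  have hq0 : 0 < q := by linarith
  have hq_ne : ENNReal.ofReal q ≠ 0 := by simpa using hq0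
  have hfLq : MemLp f (ENNReal.ofReal q) μ := by
    refine (integrable_norm_rpow_iff hf hq_ne ENNReal.ofReal_ne_top).1 ?_
    simpa [ENNReal.toReal_ofReal hq0.le] using hfq
  have hle : (2 : ENNReal) ≤ ENNReal.ofReal q := by
    simpa using ENNReal.ofReal_le_ofReal hq
  have hfL2 : MemLp f 2 μ := hfLq.mono_exponent hle
  have hnorm : (∫ x, f x ^ (2 : ℝ) ∂μ) ^ (1 / (2 : ℝ)) ≤ (∫ x, |f x| ^ q ∂μ) ^ (1 / q) := by
    have hmono := eLpNorm_le_eLpNorm_of_exponent_le hle hf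
    rw [hfL2.eLpNorm_eq_integral_rpow_norm (by simp) (by simp),
      hfLq.eLpNorm_eq_integral_rpow_norm hq_ne ENNReal.ofReal_ne_top,
      ENNReal.ofReal_le_ofReal_iff (by positivity)] at hmono
    simpa [ENNReal.toReal_ofReal hq0.le] using hmono
  have hholder := integral_mul_le_Lp_mul_Lq_of_nonneg Real.HolderConjugate.two_two
    hf0 hg0 (by simpa using hfL2) (by simpa using hg)
  refine hholder.trans ?_
  rw [Real.sqrt_eq_rpow]
  simp only [Real.rpow_two] at hnorm ⊢
  gcongr

/-- The algebra behind the pinching estimate, with `m` the second moment of `r`. -/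
lemma sq_mul_sub_le_of_pinching {k : ℕ} (hk : 2 ≤ k) {R h m C : ℝ} (hR : 0 < R) (hh : 0 < h)
    (hm : 0 ≤ m) (hmR : m ≤ R ^ 2) (hlow : 1 ≤ R ^ (k - 1) * (h * √m)) (hC0 : 0 < C)
    (hC1 : C < 1) (hpinch : R ^ k < 1 / h + C) :
    R ^ 2 * (R ^ 2 - m)
      ≤ C * (h ^ ((2 * (k : ℝ) - 4) / (k : ℝ)) + 2 * h ^ (((k : ℝ) - 4) / (k : ℝ))) := by
  obtain ⟨n, rfl⟩ := Nat.exists_eq_add_of_le' hk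
  set K : ℝ := ((n + 2 : ℕ) : ℝ) with hK
  have hK0 : 0 < K := by positivity
  simp only [show n + 2 - 1 = n + 1 by lia] at hlow
  set a := h ^ (1 / K) with ha
  have ha0 : 0 < a := by positivity
  have hak : a ^ (n + 2) = h := by
    rw [ha, ← Real.rpow_natCast, ← Real.rpow_mul hh.le, ← hK, one_div_mul_cancel hK0.ne',
      Real.rpow_one]
  have hexp₁ : h ^ ((2 * K - 4) / K) = (a ^ n) ^ 2 := by
    rw [ha, ← pow_mul, ← Real.rpow_natCast, ← Real.rpow_mul hh.le]
    congr 1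
    rw [hK]; push_cast; field_simp; ring
  have hexp₂ : h ^ ((K - 4) / K) = (a ^ n) ^ 2 / h := by
    rw [← hexp₁, ← Real.rpow_sub_one hh.ne']
    congr 1
    field_simp; ring
  have hsqrt : √m ≤ R := Real.sqrt_le_iff.2 ⟨hR.le, hmR⟩
  have hRa : 1 ≤ R * a := by
    refine (one_le_pow_iff_of_nonneg (by positivity) (by lia : n + 2 ≠ 0)).1 ?_
    calc (1 : ℝ) ≤ R ^ (n + 1) * (h * √m) := hlow
      _ ≤ R ^ (n + 1) * (h * R) := by gcongr
      _ = (R * a) ^ (n + 2) := by rw [mul_pow, hak]; ring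
  have hRan : 1 ≤ (R ^ n * a ^ n) ^ 2 := by
    rw [← mul_pow]
    exact one_le_pow₀ (one_le_pow₀ hRa)
  have hmoment : (1 / h) ^ 2 ≤ (R ^ (n + 1)) ^ 2 * m := by
    have hle : 1 / h ≤ R ^ (n + 1) * √m := by
      rw [div_le_iff₀ hh]; linarith
    calc (1 / h) ^ 2 ≤ (R ^ (n + 1) * √m) ^ 2 := by gcongr
      _ = (R ^ (n + 1)) ^ 2 * m := by rw [mul_pow, Real.sq_sqrt hm]
  have hdefect : (R ^ n) ^ 2 * (R ^ 2 * (R ^ 2 - m)) ≤ C * (C + 2 / h) := by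
    calc (R ^ n) ^ 2 * (R ^ 2 * (R ^ 2 - m))
        = (R ^ (n + 2)) ^ 2 - (R ^ (n + 1)) ^ 2 * m := by ring
      _ ≤ (R ^ (n + 2)) ^ 2 - (1 / h) ^ 2 := by gcongr
      _ = (R ^ (n + 2) - 1 / h) * (R ^ (n + 2) + 1 / h) := by ring
      _ ≤ C * (C + 2 / h) := by
        have hsum : R ^ (n + 2) + 1 / h ≤ C + 2 / h := by
          have : 2 / h = 1 / h + 1 / h := by ring
          linarith
        gcongr
        linarith
  have hnonneg : 0 ≤ R ^ 2 * (R ^ 2 - m) := mul_nonneg (by positivity) (by linarith)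
  calc R ^ 2 * (R ^ 2 - m) ≤ (R ^ n * a ^ n) ^ 2 * (R ^ 2 * (R ^ 2 - m)) :=
        le_mul_of_one_le_left hnonneg hRan
    _ = (a ^ n) ^ 2 * ((R ^ n) ^ 2 * (R ^ 2 * (R ^ 2 - m))) := by ring
    _ ≤ (a ^ n) ^ 2 * (C * (1 + 2 / h)) := by
        refine mul_le_mul_of_nonneg_left (hdefect.trans ?_) (by positivity)
        gcongr
    _ = C * (h ^ ((2 * K - 4) / K) + 2 * h ^ ((K - 4) / K)) := by
        rw [hexp₁, hexp₂]; ring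

/-- L²-pinching estimate for φ = R² − r² (Lemma 4.1, δ = 0) in
measure-theoretic form. -/
theorem pinching_L2_phi_euclidean
    {Ω : Type*} [MeasurableSpace Ω] (μ : Measure Ω) [IsProbabilityMeasure μ]
    (k : ℕ) (hk : 2 ≤ k) (p : ℝ) (hp : 1 ≤ p) (R : ℝ) (hR : 0 < R)
    (r : Ω → ℝ) (hr : Measurable r) (hr' : ∀ᵐ x ∂μ, 0 ≤ r x ∧ r x ≤ R)
    (H : ℕ → Ω → ℝ) (hH0 : ∀ x, H 0 x = 1)
    (hHint : ∀ j ≤ k, Integrable (H j) μ)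
    (hHpos : ∀ j, 1 ≤ j → j ≤ k → ∀ᵐ x ∂μ, 0 < H j x)
    (hHrint : ∀ j ≤ k, Integrable (fun x => H j x * r x) μ)
    (hHkLp : Integrable (fun x => |H k x| ^ (2 * p)) μ)
    (h : ℝ) (hh : h = (∫ x, |H k x| ^ (2 * p) ∂μ) ^ (1 / (2 * p)))
    (hmink : ∀ j, 1 ≤ j → j ≤ k → ∫ x, H (j - 1) x ∂μ ≤ ∫ x, H j x * r x ∂μ)
    (C : ℝ) (hC0 : 0 < C) (hC1 : C < 1) (hpinch : R ^ k < 1 / h + C) :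
    ∫ x, (R ^ 2 - r x ^ 2) ^ 2 ∂μ
      ≤ C * (h ^ ((2 * (k : ℝ) - 4) / (k : ℝ)) + 2 * h ^ (((k : ℝ) - 4) / (k : ℝ))) := by
  have hr0 : 0 ≤ᵐ[μ] r := hr'.mono fun x hx => hx.1
  have hrR : ∀ᵐ x ∂μ, r x ≤ R := hr'.mono fun x hx => hx.2
  have hrL2 : MemLp r 2 μ := MemLp.of_bound hr.aestronglyMeasurable R <| by
    filter_upwards [hr'] with x hx
    rw [Real.norm_of_nonneg hx.1]
    exact hx.2
  have hr2 : Integrable (fun x => r x ^ 2) μ := hrL2.integrable_sq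
  set m := ∫ x, r x ^ 2 ∂μ with hm_def
  have hm : 0 ≤ m := integral_nonneg fun x => sq_nonneg _
  have hmR : m ≤ R ^ 2 := by
    calc m ≤ ∫ _, R ^ 2 ∂μ := by
          refine integral_mono_ae hr2 (integrable_const _) ?_
          filter_upwards [hr'] with x hx
          exact pow_le_pow_left₀ hx.1 hx.2 2
      _ = R ^ 2 := by simp
  have hlow : 1 ≤ R ^ (k - 1) * (h * √m) := by
    calc 1 ≤ R ^ (k - 1) * ∫ x, H (k - 1) x ∂μ :=
          one_le_pow_mul_integral hR.le hrR hH0 hHint hHpos hHrint hmink (by lia)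
      _ ≤ R ^ (k - 1) * ∫ x, H k x * r x ∂μ := by
          exact mul_le_mul_of_nonneg_left (hmink k (by lia) le_rfl) (by positivity)
      _ ≤ R ^ (k - 1) * (h * √m) := by
          gcongr
          rw [hh]
          exact integral_mul_le_rpow_integral_mul_sqrt (by linarith)
            (hHint k le_rfl).aestronglyMeasurable
            ((hHpos k (by lia) le_rfl).mono fun x hx => hx.le) hr0 hHkLp hrL2
  have hh0 : 0 < h := by
    have : 0 ≤ h := by rw [hh]; positivity
    refine this.lt_of_ne fun h0 => ?_
    simp only [← h0, zero_mul, mul_zero] at hlow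
    linarith
  calc ∫ x, (R ^ 2 - r x ^ 2) ^ 2 ∂μ ≤ ∫ x, R ^ 2 * (R ^ 2 - r x ^ 2) ∂μ := by
        refine integral_mono_of_nonneg (.of_forall fun x => sq_nonneg _)
          (((integrable_const _).sub hr2).const_mul _) ?_
        filter_upwards [hr'] with x hx
        have := pow_le_pow_left₀ hx.1 hx.2 2
        rw [sq (R ^ 2 - r x ^ 2)]
        exact mul_le_mul_of_nonneg_right (sub_le_self _ (sq_nonneg _)) (sub_nonneg.2 this)
    _ = R ^ 2 * (R ^ 2 - m) := by
        rw [integral_const_mul, integral_sub (integrable_const _) hr2]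
        simp [hm_def]
    _ ≤ _ := sq_mul_sub_le_of_pinching hk hR hh0 hm hmR hlow hC0 hC1 hpinch
end

section
/- Let (Ω, μ) be a probability measure space, let k ≥ 1, p ≥ 1, 0 < R < π/2, and let r : Ω → ℝ be measurable with 0 ≤ r ≤ R μ-almost everywhere. Let H₀ = 1 and let H₁, …, H_k : Ω → ℝ be positive μ-a.e., with H_k ∈ L^{2p}(μ) and h := ‖H_k‖_{L^{2p}(μ)}, and assume ∫ H_{j−1} · cos(r) dμ ≤ ∫ H_j · sin(r) dμ for every 1 ≤ j ≤ k. If 0 < C < 1 and tan(R)^k < 1/h + C, then ∫ ( sin²(R) − sin²(r) )² dμ ≤ C · ( h^{(2k−2)/k} + 2 h^{(k−2)/k} ). -/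
open MeasureTheory Real

/-- The Cauchy–Schwarz inequality for integrals of real functions, in squared form. -/
theorem sq_integral_mul_le_integral_sq_mul_integral_sq {Ω : Type*} [MeasurableSpace Ω]
    {μ : Measure Ω} {f g : Ω → ℝ} (hf : Integrable (fun x => f x ^ 2) μ)
    (hg : Integrable (fun x => g x ^ 2) μ) (hfg : Integrable (fun x => f x * g x) μ) :
    (∫ x, f x * g x ∂μ) ^ 2 ≤ (∫ x, f x ^ 2 ∂μ) * ∫ x, g x ^ 2 ∂μ := by
  have key : ∀ t : ℝ, 0 ≤ (∫ x, f x ^ 2 ∂μ) * (t * t) + (2 * ∫ x, f x * g x ∂μ) * t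
      + ∫ x, g x ^ 2 ∂μ := by
    intro t
    have h0 : 0 ≤ ∫ x, (t * f x + g x) ^ 2 ∂μ := integral_nonneg fun x => sq_nonneg _
    have h1 : ∫ x, (t * f x + g x) ^ 2 ∂μ
        = ∫ x, (t * t * f x ^ 2 + 2 * t * (f x * g x) + g x ^ 2) ∂μ := by
      congr 1
      ext x
      ring
    have hf' : Integrable (fun x => t * t * f x ^ 2) μ := hf.const_mul _
    have hfg' : Integrable (fun x => 2 * t * (f x * g x)) μ := hfg.const_mul _
    have hadd : Integrable (fun x => t * t * f x ^ 2 + 2 * t * (f x * g x)) μ := hf'.add hfg'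
    rw [h1, integral_add hadd hg, integral_add hf' hfg', integral_const_mul,
      integral_const_mul] at h0
    linarith
  have hd := discrim_le_zero key
  unfold discrim at hd
  linarith

/-- Monotonicity of `L^q` norms on a probability space, between the exponents `2` and `2 * p`. -/
theorem integrable_sq_and_integral_sq_le_of_integrable_rpow {Ω : Type*} [MeasurableSpace Ω]
    {μ : Measure Ω} [IsProbabilityMeasure μ] {f : Ω → ℝ} {p : ℝ} (hp : 1 ≤ p)
    (hf : AEStronglyMeasurable f μ) (hfp : Integrable (fun x => |f x| ^ (2 * p)) μ) :
    Integrable (fun x => f x ^ 2) μ ∧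
      ∫ x, f x ^ 2 ∂μ ≤ ((∫ x, |f x| ^ (2 * p) ∂μ) ^ (1 / (2 * p))) ^ 2 := by
  have hp0 : 0 < p := by linarith
  have hpow : ∀ x, |f x| ^ (2 * p) = (f x ^ 2) ^ p := by
    intro x
    rw [rpow_mul (abs_nonneg _), rpow_two, sq_abs]
  have hint : Integrable (fun x => f x ^ 2) μ := by
    refine ((integrable_const (1 : ℝ)).add hfp).mono' (hf.pow 2) (ae_of_all _ fun x => ?_)
    rw [norm_of_nonneg (sq_nonneg _), Pi.add_apply, hpow]
    rcases le_total (f x ^ 2) 1 with h1 | h1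
    · linarith [rpow_nonneg (sq_nonneg (f x)) p]
    · linarith [self_le_rpow_of_one_le h1 hp]
  refine ⟨hint, ?_⟩
  have hjensen : (∫ x, f x ^ 2 ∂μ) ^ p ≤ ∫ x, (f x ^ 2) ^ p ∂μ := by
    refine (convexOn_rpow hp).map_integral_le (continuous_rpow_const hp0.le).continuousOn
      isClosed_Ici (ae_of_all _ fun x => sq_nonneg (f x)) hint ?_
    simpa only [Function.comp_def, hpow] using hfp
  simp only [hpow]
  have h0 : 0 ≤ ∫ x, f x ^ 2 ∂μ := integral_nonneg fun x => sq_nonneg _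
  have h1 : 0 ≤ ∫ x, (f x ^ 2) ^ p ∂μ := integral_nonneg fun x => rpow_nonneg (sq_nonneg _) _
  rw [← rpow_natCast _ 2, ← rpow_mul h1]
  have he : 1 / (2 * p) * ((2 : ℕ) : ℝ) = p⁻¹ := by
    push_cast
    field_simp
  rw [he]
  calc ∫ x, f x ^ 2 ∂μ = ((∫ x, f x ^ 2 ∂μ) ^ p) ^ p⁻¹ := (rpow_rpow_inv h0 hp0.ne').symm
    _ ≤ _ := rpow_le_rpow (rpow_nonneg h0 _) hjensen (inv_nonneg.2 hp0.le)

/-- The chain of Hsiung–Minkowski inequalities, closed up by `sin r ≤ tan R * cos r`. -/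
theorem integral_cos_le_tan_pow_mul_integral_mul_sin {Ω : Type*} [MeasurableSpace Ω]
    {μ : Measure Ω} {k : ℕ} {R : ℝ} (hR : 0 ≤ tan R) {r : Ω → ℝ} (hr : Measurable r)
    (hsc : ∀ᵐ x ∂μ, sin (r x) ≤ tan R * cos (r x))
    {H : ℕ → Ω → ℝ} (hH0 : ∀ x, H 0 x = 1) (hHint : ∀ j ≤ k, Integrable (H j) μ)
    (hHpos : ∀ j, 1 ≤ j → j ≤ k → ∀ᵐ x ∂μ, 0 < H j x)
    (hmink : ∀ j, 1 ≤ j → j ≤ k →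
      ∫ x, H (j - 1) x * cos (r x) ∂μ ≤ ∫ x, H j x * sin (r x) ∂μ) (j : ℕ) (hj : j + 1 ≤ k) :
    ∫ x, cos (r x) ∂μ ≤ tan R ^ j * ∫ x, H (j + 1) x * sin (r x) ∂μ := by
  induction j with
  | zero => simpa [hH0] using hmink 1 le_rfl hj
  | succ j ih =>
    have hcos : Integrable (fun x => H (j + 1) x * cos (r x)) μ :=
      (hHint _ (by omega)).mul_bdd (c := 1) hr.cos.aestronglyMeasurable
        (ae_of_all _ fun x => abs_cos_le_one _)
    have hsin : Integrable (fun x => H (j + 1) x * sin (r x)) μ :=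
      (hHint _ (by omega)).mul_bdd (c := 1) hr.sin.aestronglyMeasurable
        (ae_of_all _ fun x => abs_sin_le_one _)
    have hstep : ∫ x, H (j + 1) x * sin (r x) ∂μ ≤ tan R * ∫ x, H (j + 1) x * cos (r x) ∂μ := by
      rw [← integral_const_mul]
      refine integral_mono_ae hsin (hcos.const_mul _) ?_
      filter_upwards [hsc, hHpos (j + 1) (by omega) (by omega)] with x hx hpos
      nlinarith [mul_le_mul_of_nonneg_left hx hpos.le]
    calc ∫ x, cos (r x) ∂μ ≤ tan R ^ j * ∫ x, H (j + 1) x * sin (r x) ∂μ := ih (by omega)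
      _ ≤ tan R ^ j * (tan R * ∫ x, H (j + 2) x * sin (r x) ∂μ) := by
          gcongr
          exact hstep.trans (mul_le_mul_of_nonneg_left (hmink (j + 2) (by omega) hj) hR)
      _ = _ := by ring

/-- The algebraic part of the pinching estimate. -/
theorem pow_four_sub_le_of_pinched {k : ℕ} (hk : 1 ≤ k) {S T B h C : ℝ} (hS0 : 0 < S)
    (hS1 : S ≤ 1) (hST : S ≤ T) (hh : 0 < h) (hC0 : 0 < C) (hC1 : C < 1)
    (hB : S ^ 2 ≤ (T ^ k * h) ^ 2 * B) (hone : 1 ≤ T ^ k * h) (hpinch : T ^ k < 1 / h + C) :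
    S ^ 2 * (S ^ 2 - B)
      ≤ C * (h ^ ((2 * (k : ℝ) - 2) / (k : ℝ)) + 2 * h ^ (((k : ℝ) - 2) / (k : ℝ))) := by
  have hT : 0 < T := hS0.trans_le hST
  have hk0 : (k : ℝ) ≠ 0 := by positivity
  have e1 : h ^ ((2 * (k : ℝ) - 2) / (k : ℝ)) = h ^ (-2 / (k : ℝ)) * h ^ 2 := by
    rw [← rpow_natCast h 2, ← rpow_add hh]
    congr 1
    push_cast
    field_simp
    ring
  have e2 : h ^ (((k : ℝ) - 2) / (k : ℝ)) = h ^ (-2 / (k : ℝ)) * h := by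
    nth_rewrite 3 [← rpow_one h]
    rw [← rpow_add hh]
    congr 1
    field_simp
    ring
  set u := T ^ k * h with hu
  have hu0 : 0 < u := by positivity
  have huC : u < 1 + C * h := by
    calc u < (1 / h + C) * h := mul_lt_mul_of_pos_right hpinch hh
      _ = 1 + C * h := by field_simp
  have hu2 : u ^ 2 - 1 ≤ C * (h ^ 2 + 2 * h) := by
    have hCh : 0 < C * h ^ 2 := by positivity
    nlinarith [mul_pos hC0 hh]
  have hTu : T ^ 2 * u ^ (-2 / (k : ℝ)) = h ^ (-2 / (k : ℝ)) := by
    rw [hu, mul_rpow (by positivity) hh.le, ← mul_assoc, ← rpow_natCast T k, ← rpow_mul hT.le,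
      mul_div_cancel₀ _ hk0, rpow_neg hT.le, rpow_two, mul_inv_cancel₀ (by positivity), one_mul]
  have hmain : S ^ 4 / u ^ 2 ≤ h ^ (-2 / (k : ℝ)) := by
    rw [← hTu, div_eq_mul_inv]
    have h4 : S ^ 4 ≤ T ^ 2 :=
      (pow_le_pow_of_le_one hS0.le hS1 (by norm_num)).trans (pow_le_pow_left₀ hS0.le hST 2)
    have hu3 : (u ^ 2)⁻¹ ≤ u ^ (-2 / (k : ℝ)) := by
      rw [← rpow_two, ← rpow_neg hu0.le]
      refine rpow_le_rpow_of_exponent_le hone ?_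
      rw [le_div_iff₀ (by positivity)]
      have : (1 : ℝ) ≤ k := by exact_mod_cast hk
      linarith
    exact mul_le_mul h4 hu3 (by positivity) (by positivity)
  have hB' : S ^ 2 / u ^ 2 ≤ B := by
    rw [div_le_iff₀ (by positivity)]
    linarith
  calc S ^ 2 * (S ^ 2 - B) ≤ S ^ 2 * (S ^ 2 - S ^ 2 / u ^ 2) := by gcongr
    _ = S ^ 4 / u ^ 2 * (u ^ 2 - 1) := by
        field_simp
    _ ≤ h ^ (-2 / (k : ℝ)) * (C * (h ^ 2 + 2 * h)) :=
        mul_le_mul hmain hu2 (by nlinarith) (by positivity)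
    _ = _ := by rw [e1, e2]; ring

/-- L²-pinching estimate for φ = sin²R − sin²r (Lemma 4.1, δ = 1,
open hemisphere) in measure-theoretic form. -/
theorem pinching_L2_phi_sphere
    {Ω : Type*} [MeasurableSpace Ω] (μ : Measure Ω) [IsProbabilityMeasure μ]
    (k : ℕ) (hk : 1 ≤ k) (p : ℝ) (hp : 1 ≤ p) (R : ℝ) (hR : 0 < R) (hR' : R < π / 2)
    (r : Ω → ℝ) (hr : Measurable r) (hr' : ∀ᵐ x ∂μ, 0 ≤ r x ∧ r x ≤ R)
    (H : ℕ → Ω → ℝ) (hH0 : ∀ x, H 0 x = 1)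
    (hHint : ∀ j ≤ k, Integrable (H j) μ)
    (hHpos : ∀ j, 1 ≤ j → j ≤ k → ∀ᵐ x ∂μ, 0 < H j x)
    (hHkLp : Integrable (fun x => |H k x| ^ (2 * p)) μ)
    (h : ℝ) (hh : h = (∫ x, |H k x| ^ (2 * p) ∂μ) ^ (1 / (2 * p)))
    (hmink : ∀ j, 1 ≤ j → j ≤ k →
      ∫ x, H (j - 1) x * Real.cos (r x) ∂μ ≤ ∫ x, H j x * Real.sin (r x) ∂μ)
    (C : ℝ) (hC0 : 0 < C) (hC1 : C < 1) (hpinch : Real.tan R ^ k < 1 / h + C) :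
    ∫ x, (Real.sin R ^ 2 - Real.sin (r x) ^ 2) ^ 2 ∂μ
      ≤ C * (h ^ ((2 * (k : ℝ) - 2) / (k : ℝ)) + 2 * h ^ (((k : ℝ) - 2) / (k : ℝ))) := by
  have hS : 0 < sin R := sin_pos_of_pos_of_lt_pi hR (by linarith [pi_pos])
  have hCo : 0 < cos R := cos_pos_of_mem_Ioo ⟨by linarith, hR'⟩
  have hT : 0 < tan R := tan_pos_of_pos_of_lt_pi_div_two hR hR'
  have hTC : tan R * cos R = sin R := tan_mul_cos hCo.ne'
  have hST : sin R ≤ tan R := by nlinarith [cos_le_one R]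
  have hsin : ∀ᵐ x ∂μ, 0 ≤ sin (r x) ∧ sin (r x) ≤ sin R := by
    filter_upwards [hr'] with x hx
    exact ⟨sin_nonneg_of_nonneg_of_le_pi hx.1 (by linarith [pi_pos, hx.2]),
      sin_le_sin_of_le_of_le_pi_div_two (by linarith [pi_pos, hx.1]) hR'.le hx.2⟩
  have hcos : ∀ᵐ x ∂μ, cos R ≤ cos (r x) := by
    filter_upwards [hr'] with x hx
    exact cos_le_cos_of_nonneg_of_le_pi hx.1 (by linarith [pi_pos]) hx.2
  have hsc : ∀ᵐ x ∂μ, sin (r x) ≤ tan R * cos (r x) := by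
    filter_upwards [hsin, hcos] with x h1 h2
    calc sin (r x) ≤ tan R * cos R := hTC ▸ h1.2
      _ ≤ _ := by gcongr
  have hIcos : Integrable (fun x => cos (r x)) μ :=
    Integrable.of_bound hr.cos.aestronglyMeasurable 1 (ae_of_all _ fun x => abs_cos_le_one _)
  have hIsin2 : Integrable (fun x => sin (r x) ^ 2) μ := by
    refine Integrable.of_bound (hr.sin.pow_const 2).aestronglyMeasurable 1
      (ae_of_all _ fun x => ?_)
    rw [norm_of_nonneg (sq_nonneg _)]
    exact sin_sq_le_one _
  have hIHs : Integrable (fun x => H k x * sin (r x)) μ :=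
    (hHint k le_rfl).mul_bdd (c := 1) hr.sin.aestronglyMeasurable
      (ae_of_all _ fun x => abs_sin_le_one _)
  have hcosle : cos R ≤ ∫ x, cos (r x) ∂μ := by
    simpa using integral_mono_ae (integrable_const (cos R)) hIcos hcos
  have hchain := integral_cos_le_tan_pow_mul_integral_mul_sin hT.le hr hsc hH0 hHint hHpos hmink
    (k - 1) (by omega)
  rw [Nat.sub_add_cancel hk] at hchain
  obtain ⟨hH2, hH2le⟩ := integrable_sq_and_integral_sq_le_of_integrable_rpow hp
    (hHint k le_rfl).aestronglyMeasurable hHkLp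
  rw [← hh] at hH2le
  have hCS := sq_integral_mul_le_integral_sq_mul_integral_sq hH2 hIsin2 hIHs
  set B := ∫ x, sin (r x) ^ 2 ∂μ with hBdef
  set I := ∫ x, H k x * sin (r x) ∂μ
  have hB0 : 0 ≤ B := integral_nonneg fun x => sq_nonneg _
  have hBle : B ≤ sin R ^ 2 := by
    have hle : ∀ᵐ x ∂μ, sin (r x) ^ 2 ≤ sin R ^ 2 := by
      filter_upwards [hsin] with x hx
      exact pow_le_pow_left₀ hx.1 hx.2 2
    simpa using integral_mono_ae hIsin2 (integrable_const (sin R ^ 2)) hle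
  have hh0 : 0 ≤ h := hh ▸ rpow_nonneg (integral_nonneg fun x => rpow_nonneg (abs_nonneg _) _) _
  have hSI : sin R ≤ tan R ^ k * I := by
    calc sin R = tan R * cos R := hTC.symm
      _ ≤ tan R * (tan R ^ (k - 1) * I) := by
          gcongr
          exact hcosle.trans hchain
      _ = tan R ^ k * I := by rw [← mul_assoc, ← pow_succ', Nat.sub_add_cancel hk]
  have hB : sin R ^ 2 ≤ (tan R ^ k * h) ^ 2 * B := by
    calc sin R ^ 2 ≤ (tan R ^ k * I) ^ 2 := pow_le_pow_left₀ hS.le hSI 2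
      _ = (tan R ^ k) ^ 2 * I ^ 2 := by ring
      _ ≤ (tan R ^ k) ^ 2 * (h ^ 2 * B) := by
          gcongr
          exact hCS.trans (mul_le_mul_of_nonneg_right hH2le hB0)
      _ = _ := by ring
  have hone : 1 ≤ tan R ^ k * h := by
    have h1 : 1 * sin R ^ 2 ≤ (tan R ^ k * h) ^ 2 * sin R ^ 2 := by
      rw [one_mul]
      exact hB.trans (mul_le_mul_of_nonneg_left hBle (sq_nonneg _))
    have h2 : 1 ≤ (tan R ^ k * h) ^ 2 := le_of_mul_le_mul_right h1 (by positivity)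
    exact (one_le_sq_iff₀ (by positivity)).1 h2
  have hhpos : 0 < h := by
    refine hh0.lt_of_ne fun h0 => ?_
    rw [← h0] at hone
    norm_num at hone
  refine le_trans ?_ (pow_four_sub_le_of_pinched hk hS (sin_le_one R) hST hhpos hC0 hC1 hB hone
    hpinch)
  have hIφ : Integrable (fun x => sin R ^ 2 - sin (r x) ^ 2) μ := (integrable_const _).sub hIsin2
  have hφ : ∫ x, (sin R ^ 2 - sin (r x) ^ 2) ∂μ = sin R ^ 2 - B := by
    rw [integral_sub (integrable_const _) hIsin2]
    simp [hBdef]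
  rw [← hφ, ← integral_const_mul]
  refine integral_mono_of_nonneg (ae_of_all _ fun x => sq_nonneg _) (hIφ.const_mul _) ?_
  filter_upwards [hsin] with x hx
  have h1 : sin (r x) ^ 2 ≤ sin R ^ 2 := pow_le_pow_left₀ hx.1 hx.2 2
  nlinarith [mul_nonneg (sq_nonneg (sin (r x))) (sub_nonneg.2 h1)]
end
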